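/- Let G be a unicyclic graph and let S be a biactive branch-resolving set in G, with the cycle C canonically labelled with respect to S. If G contains none of the configurations A, B, and C with respect to S, then S is a vertex metric generator of G. -/

import Mathlib

open SimpleGraph

section Defs

variable {V : Type*}

/-- Distance from a vertex `s` to an edge `e`: the minimum of the distances to its endpoints. -/
noncomputable def edgeDist (G : SimpleGraph V) (s : V) (e : Sym2 V) : ℕ :=
  Sym2.lift ⟨fun u w => min (G.dist s u) (G.dist s w), fun u w => min_comm _ _⟩ e

/-- `S` is a vertex metric generator of `G`. -/
def IsVertexMG (G : SimpleGraph V) (S : Set V) : Prop :=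
  ∀ u v : V, u ≠ v → ∃ s ∈ S, G.dist s u ≠ G.dist s v

/-- `S` is an edge metric generator of `G`. -/
def IsEdgeMG (G : SimpleGraph V) (S : Set V) : Prop :=
  ∀ e ∈ G.edgeSet, ∀ f ∈ G.edgeSet, e ≠ f → ∃ s ∈ S, edgeDist G s e ≠ edgeDist G s f

/-- The vertex metric dimension of `G`. -/
noncomputable def metricDim (G : SimpleGraph V) : ℕ :=
  sInf {n | ∃ S : Finset V, S.card = n ∧ IsVertexMG G ↑S}

/-- The edge metric dimension of `G`. -/
noncomputable def edgeMetricDim (G : SimpleGraph V) : ℕ :=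
  sInf {n | ∃ S : Finset V, S.card = n ∧ IsEdgeMG G ↑S}

/-- `G` is unicyclic: connected, contains a cycle, and any two cycles have the same edges. -/
def IsUnicyclic (G : SimpleGraph V) : Prop :=
  G.Connected ∧ (∃ (u : V) (w : G.Walk u u), w.IsCycle) ∧
    ∀ (u u' : V) (w : G.Walk u u) (w' : G.Walk u' u'), w.IsCycle → w'.IsCycle →
      ∀ e, e ∈ w.edges ↔ e ∈ w'.edges

/-- `vc : ZMod g → V` is a labelling `v_0 v_1 ⋯ v_{g-1}` of a cycle of length `g` in `G`. -/
def IsCycleLabelling (G : SimpleGraph V) (g : ℕ) (vc : ZMod g → V) : Prop :=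
  Function.Injective vc ∧ ∀ i : ZMod g, G.Adj (vc i) (vc (i + 1))

/-- The set of edges of the cycle `C`. -/
def cycleEdges (g : ℕ) (vc : ZMod g → V) : Set (Sym2 V) :=
  {e | ∃ i : ZMod g, e = s(vc i, vc (i + 1))}

/-- The graph `G - E(C)`. -/
def offCycle (G : SimpleGraph V) (g : ℕ) (vc : ZMod g → V) : SimpleGraph V :=
  G.deleteEdges (cycleEdges g vc)

/-- `x` belongs to `T_{v_i}`, the connected component of `G - E(C)` containing `v_i`. -/
def inTree (G : SimpleGraph V) (g : ℕ) (vc : ZMod g → V) (i : ZMod g) (x : V) : Prop :=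
  (offCycle G g vc).Reachable (vc i) x

/-- The vertex `v_i` of the cycle is `S`-active: `T_{v_i}` contains a vertex of `S`. -/
def SActive (G : SimpleGraph V) (g : ℕ) (vc : ZMod g → V) (S : Set V) (i : ZMod g) : Prop :=
  ∃ s ∈ S, inTree G g vc i s

/-- `a_S(C)`: the number of `S`-active vertices on the cycle. -/
noncomputable def aS (G : SimpleGraph V) (g : ℕ) (vc : ZMod g → V) (S : Set V) : ℕ :=
  {i : ZMod g | SActive G g vc S i}.ncard

/-- `S` is biactive: `a_S(C) ≥ 2`. -/
def Biactive (G : SimpleGraph V) (g : ℕ) (vc : ZMod g → V) (S : Set V) : Prop :=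
  2 ≤ aS G g vc S

variable [Fintype V] [DecidableEq V]

/-- `t = u_1 u_2 ⋯ u_k` is a thread hanging at the vertex `v`. -/
def IsThreadAt (G : SimpleGraph V) [DecidableRel G.Adj] (v : V) (t : List V) : Prop :=
  t ≠ [] ∧ t.Nodup ∧ v ∉ t ∧ 3 ≤ G.degree v ∧ List.Chain' G.Adj t ∧
    (∀ u ∈ t.head?, G.Adj v u) ∧ (∀ u ∈ t.getLast?, G.degree u = 1) ∧
    ∀ u ∈ t.dropLast, G.degree u = 2

/-- The thread `t` is `S`-free: it contains no vertex of `S`. -/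
def SFree (S : Set V) (t : List V) : Prop := ∀ u ∈ t, u ∉ S

/-- `S` is branch-resolving: for every vertex, all threads hanging at it except possibly
one contain a vertex of `S` (i.e. at most one thread at each vertex is `S`-free). -/
def BranchResolving (G : SimpleGraph V) [DecidableRel G.Adj] (S : Set V) : Prop :=
  ∀ v : V, ∀ t₁ t₂ : List V, IsThreadAt G v t₁ → IsThreadAt G v t₂ → t₁ ≠ t₂ →
    (∃ s ∈ S, s ∈ t₁) ∨ (∃ s ∈ S, s ∈ t₂)

/-- `ℓ(v)`: the number of threads hanging at `v`. -/
noncomputable def numThreads (G : SimpleGraph V) [DecidableRel G.Adj] (v : V) : ℕ :=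
  {t : List V | IsThreadAt G v t}.ncard

/-- `L(G) = Σ (ℓ(v) - 1)` (truncated subtraction makes the sum run exactly over the
vertices with `ℓ(v) > 1`). -/
noncomputable def LG (G : SimpleGraph V) [DecidableRel G.Adj] : ℕ :=
  ∑ v : V, (numThreads G v - 1)

/-- `x` is a branching vertex of the unicyclic graph with cycle `vc`. -/
def Branching (G : SimpleGraph V) [DecidableRel G.Adj] (g : ℕ) (vc : ZMod g → V) (x : V) :
    Prop :=
  (x ∉ Set.range vc ∧ 3 ≤ G.degree x) ∨ (x ∈ Set.range vc ∧ 4 ≤ G.degree x)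

/-- The cycle vertex `v_i` is branch-active: `T_{v_i}` contains a branching vertex. -/
def BranchActive (G : SimpleGraph V) [DecidableRel G.Adj] (g : ℕ) (vc : ZMod g → V)
    (i : ZMod g) : Prop :=
  ∃ x, inTree G g vc i x ∧ Branching G g vc x

/-- `b(G)`: the number of branch-active vertices on the cycle. -/
noncomputable def bG (G : SimpleGraph V) [DecidableRel G.Adj] (g : ℕ) (vc : ZMod g → V) : ℕ :=
  {i : ZMod g | BranchActive G g vc i}.ncard

/-- `k = max { i : v_i is S-active }` for the labelling `vc` (indices taken in `[0, g-1]`). -/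
noncomputable def kOf (G : SimpleGraph V) (g : ℕ) (vc : ZMod g → V) (S : Set V) : ℕ :=
  sSup {n : ℕ | n < g ∧ SActive G g vc S (n : ZMod g)}

/-- The labelling `vc` of the cycle is canonical with respect to `S`: `v_0` is `S`-active
and `k` is as small as possible among all labellings of the cycle with `v_0` `S`-active. -/
def Canonical (G : SimpleGraph V) (g : ℕ) (vc : ZMod g → V) (S : Set V) : Prop :=
  IsCycleLabelling G g vc ∧ SActive G g vc S 0 ∧
    ∀ vc' : ZMod g → V, IsCycleLabelling G g vc' → Set.range vc' = Set.range vc →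
      SActive G g vc' S 0 → kOf G g vc S ≤ kOf G g vc' S

/-- Configuration 𝒜 : `a_S(C) = 2`, `g` even and `k = g/2`. -/
def ConfigA (G : SimpleGraph V) (g : ℕ) (vc : ZMod g → V) (S : Set V) : Prop :=
  aS G g vc S = 2 ∧ Even g ∧ kOf G g vc S = g / 2

/-- Configuration ℬ : `k ≤ ⌊g/2⌋ - 1` and an `S`-free thread hangs at `v_i` for some
`i ∈ [k, ⌊g/2⌋-1] ∪ [⌈g/2⌉+k+1, g-1] ∪ {0}`. -/
def ConfigB (G : SimpleGraph V) [DecidableRel G.Adj] (g : ℕ) (vc : ZMod g → V) (S : Set V) :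
    Prop :=
  kOf G g vc S ≤ g / 2 - 1 ∧
    ∃ i : ℕ, ((kOf G g vc S ≤ i ∧ i ≤ g / 2 - 1) ∨
        ((g + 1) / 2 + kOf G g vc S + 1 ≤ i ∧ i ≤ g - 1) ∨ i = 0) ∧
      ∃ t : List V, IsThreadAt G (vc (i : ZMod g)) t ∧ SFree S t

/-- Configuration 𝒞 : `a_S(C) = 2`, `g` even, `k ≤ g/2` and an `S`-free thread of length
`≥ g/2 - k` hangs at `v_i` for some `i ∈ [0, k]`. -/
def ConfigC (G : SimpleGraph V) [DecidableRel G.Adj] (g : ℕ) (vc : ZMod g → V) (S : Set V) :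
    Prop :=
  aS G g vc S = 2 ∧ Even g ∧ kOf G g vc S ≤ g / 2 ∧
    ∃ i : ℕ, i ≤ kOf G g vc S ∧
      ∃ t : List V, IsThreadAt G (vc (i : ZMod g)) t ∧ SFree S t ∧
        g / 2 - kOf G g vc S ≤ t.length

/-- Configuration 𝒟 : `k ≤ ⌈g/2⌉ - 1` and an `S`-free thread hangs at `v_i` for some
`i ∈ [k, ⌈g/2⌉-1] ∪ [⌊g/2⌋+k+1, g-1] ∪ {0}`. -/
def ConfigD (G : SimpleGraph V) [DecidableRel G.Adj] (g : ℕ) (vc : ZMod g → V) (S : Set V) :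
    Prop :=
  kOf G g vc S ≤ (g + 1) / 2 - 1 ∧
    ∃ i : ℕ, ((kOf G g vc S ≤ i ∧ i ≤ (g + 1) / 2 - 1) ∨
        (g / 2 + kOf G g vc S + 1 ≤ i ∧ i ≤ g - 1) ∨ i = 0) ∧
      ∃ t : List V, IsThreadAt G (vc (i : ZMod g)) t ∧ SFree S t

/-- Configuration ℰ : `a_S(C) = 2` and an `S`-free thread of length `≥ ⌊g/2⌋ - k + 1`
hangs at `v_i` with `i ∈ [0, k]`; moreover if `g` is even an `S`-free thread hangs at
`v_j` with `j = g/2 + k - i`. -/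
def ConfigE (G : SimpleGraph V) [DecidableRel G.Adj] (g : ℕ) (vc : ZMod g → V) (S : Set V) :
    Prop :=
  aS G g vc S = 2 ∧
    ∃ i : ℕ, i ≤ kOf G g vc S ∧
      (∃ t : List V, IsThreadAt G (vc (i : ZMod g)) t ∧ SFree S t ∧
        g / 2 - kOf G g vc S + 1 ≤ t.length) ∧
      (Even g → ∃ t' : List V,
        IsThreadAt G (vc ((g / 2 + kOf G g vc S - i : ℕ) : ZMod g)) t' ∧ SFree S t')

/-- `G` contains configuration 𝒜 with respect to `S` (evaluated on a canonical labelling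
of the cycle given by `vc`). -/
def ContainsA (G : SimpleGraph V) (g : ℕ) (vc : ZMod g → V) (S : Set V) : Prop :=
  ∃ vc' : ZMod g → V, IsCycleLabelling G g vc' ∧ Set.range vc' = Set.range vc ∧
    Canonical G g vc' S ∧ ConfigA G g vc' S

/-- `G` contains configuration ℬ with respect to `S`. -/
def ContainsB (G : SimpleGraph V) [DecidableRel G.Adj] (g : ℕ) (vc : ZMod g → V)
    (S : Set V) : Prop :=
  ∃ vc' : ZMod g → V, IsCycleLabelling G g vc' ∧ Set.range vc' = Set.range vc ∧
    Canonical G g vc' S ∧ ConfigB G g vc' S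

/-- `G` contains configuration 𝒞 with respect to `S`. -/
def ContainsC (G : SimpleGraph V) [DecidableRel G.Adj] (g : ℕ) (vc : ZMod g → V)
    (S : Set V) : Prop :=
  ∃ vc' : ZMod g → V, IsCycleLabelling G g vc' ∧ Set.range vc' = Set.range vc ∧
    Canonical G g vc' S ∧ ConfigC G g vc' S

/-- `G` contains configuration 𝒟 with respect to `S`. -/
def ContainsD (G : SimpleGraph V) [DecidableRel G.Adj] (g : ℕ) (vc : ZMod g → V)
    (S : Set V) : Prop :=
  ∃ vc' : ZMod g → V, IsCycleLabelling G g vc' ∧ Set.range vc' = Set.range vc ∧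
    Canonical G g vc' S ∧ ConfigD G g vc' S

/-- `G` contains configuration ℰ with respect to `S`. -/
def ContainsE (G : SimpleGraph V) [DecidableRel G.Adj] (g : ℕ) (vc : ZMod g → V)
    (S : Set V) : Prop :=
  ∃ vc' : ZMod g → V, IsCycleLabelling G g vc' ∧ Set.range vc' = Set.range vc ∧
    Canonical G g vc' S ∧ ConfigE G g vc' S

/-- `G` contains one of the configurations 𝒜, ℬ, 𝒞 with respect to `S`. -/
def ContainsABC (G : SimpleGraph V) [DecidableRel G.Adj] (g : ℕ) (vc : ZMod g → V)
    (S : Set V) : Prop :=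
  ContainsA G g vc S ∨ ContainsB G g vc S ∨ ContainsC G g vc S

/-- `G` contains one of the configurations 𝒜, 𝒟, ℰ with respect to `S`. -/
def ContainsADE (G : SimpleGraph V) [DecidableRel G.Adj] (g : ℕ) (vc : ZMod g → V)
    (S : Set V) : Prop :=
  ContainsA G g vc S ∨ ContainsD G g vc S ∨ ContainsE G g vc S

/-- `S` is a smallest branch-resolving set of `G`. -/
def SmallestBR (G : SimpleGraph V) [DecidableRel G.Adj] (S : Finset V) : Prop :=
  BranchResolving G ↑S ∧ ∀ S' : Finset V, BranchResolving G ↑S' → S.card ≤ S'.card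

/-- `S` is a smallest biactive branch-resolving set of `G`. -/
def SmallestBBR (G : SimpleGraph V) [DecidableRel G.Adj] (g : ℕ) (vc : ZMod g → V)
    (S : Finset V) : Prop :=
  BranchResolving G ↑S ∧ Biactive G g vc ↑S ∧
    ∀ S' : Finset V, BranchResolving G ↑S' → Biactive G g vc ↑S' → S.card ≤ S'.card

/-- `G` is 𝒜ℬ𝒞-negative. -/
def ABCneg (G : SimpleGraph V) [DecidableRel G.Adj] (g : ℕ) (vc : ZMod g → V) : Prop :=
  ∃ S : Finset V, SmallestBBR G g vc S ∧ ¬ ContainsABC G g vc ↑S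

/-- `G` is 𝒜𝒟ℰ-negative. -/
def ADEneg (G : SimpleGraph V) [DecidableRel G.Adj] (g : ℕ) (vc : ZMod g → V) : Prop :=
  ∃ S : Finset V, SmallestBBR G g vc S ∧ ¬ ContainsADE G g vc ↑S

end Defs

section Metric

variable {V : Type*} {G : SimpleGraph V}

/-- Every vertex other than `r` has a neighbour that is closer to `r`. -/
lemma exists_adj_dist_eq_add_one (hc : G.Connected) {r x : V} (h : x ≠ r) :
    ∃ y, G.Adj x y ∧ G.dist r x = G.dist r y + 1 := by
  obtain ⟨p, hp⟩ := hc.exists_walk_length_eq_dist x r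
  cases p with
  | nil => exact absurd rfl h
  | @cons _ y _ hxy q =>
    refine ⟨y, hxy, ?_⟩
    have h1 := dist_le q
    have h2 := hc.dist_triangle (u := r) (v := y) (w := x)
    have h3 : G.dist y x = 1 := dist_eq_one_iff_adj.mpr hxy.symm
    rw [Walk.length_cons] at hp
    rw [dist_comm (u := y)] at h1
    rw [dist_comm (u := x)] at hp
    omega

/-- Every vertex other than `a` is reached through a neighbour of `a` on a geodesic. -/
lemma exists_adj_dist_eq_one_add (hc : G.Connected) {a x : V} (h : x ≠ a) :
    ∃ b, G.Adj a b ∧ G.dist a x = G.dist b x + 1 := by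
  obtain ⟨b, hab, hb⟩ := exists_adj_dist_eq_add_one hc h.symm
  exact ⟨b, hab, by rw [dist_comm, hb, dist_comm]⟩

lemma dist_le_dist_add_one (hc : G.Connected) (r : V) {x y : V} (h : G.Adj x y) :
    G.dist r y ≤ G.dist r x + 1 := by
  have h2 := hc.dist_triangle (u := r) (v := x) (w := y)
  rwa [dist_eq_one_iff_adj.mpr h] at h2

/-- A function changing by at most one along edges is `1`-Lipschitz for the graph distance. -/
lemma le_add_dist_of_adj (hc : G.Connected) (f : V → ℕ)
    (hf : ∀ x y, G.Adj x y → f y ≤ f x + 1) (x y : V) : f y ≤ f x + G.dist x y := by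
  obtain ⟨p, hp⟩ := hc.exists_walk_length_eq_dist x y
  rw [← hp]
  clear hp
  induction p with
  | nil => simp
  | cons h q ih =>
    have := hf _ _ h
    rw [Walk.length_cons]
    omega

/-- If all edges leaving `D` start at `a`, then geodesics leaving `D` pass through `a`. -/
lemma dist_eq_add_of_forall_adj_mem (hc : G.Connected) {D : Set V} {a : V}
    (hD : ∀ x ∈ D, x ≠ a → ∀ y, G.Adj x y → y ∈ D) {x y : V} (hx : x ∈ D) (hy : y ∉ D) :
    G.dist x y = G.dist x a + G.dist a y := by
  refine le_antisymm hc.dist_triangle ?_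
  obtain ⟨p, hp⟩ := hc.exists_walk_length_eq_dist x y
  rw [← hp]
  clear hp
  induction p with
  | nil => exact absurd hx hy
  | @cons u v w h q ih =>
    rw [Walk.length_cons]
    by_cases hu : u = a
    · subst hu
      have := dist_le (Walk.cons h q)
      rw [Walk.length_cons] at this
      simpa using this
    · have h1 := ih (hD u hx hu v h) hy
      have h2 := dist_le_dist_add_one hc a h.symm
      rw [dist_comm, dist_comm (u := a)] at h2
      omega

end Metric

section HangingTree

variable {V : Type*}

/-- `T` spans a tree with root `r` which is attached to the rest of `G` at `r` only, where `r`
has at least two neighbours outside `T`. -/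
structure HangingTree (G : SimpleGraph V) (r : V) (T : Set V) : Prop where
  adj_mem : ∀ x ∈ T, x ≠ r → ∀ y, G.Adj x y → y ∈ T
  parent_unique : ∀ x ∈ T, x ≠ r → ∀ y z, G.Adj x y → G.Adj x z →
    G.dist r y ≤ G.dist r x → G.dist r z ≤ G.dist r x → y = z
  root_adj : ∃ y z, y ≠ z ∧ y ∉ T ∧ z ∉ T ∧ G.Adj r y ∧ G.Adj r z

/-- The descendants of `a` in `T` with respect to the root `r`. -/
def descendants (G : SimpleGraph V) (r : V) (T : Set V) (a : V) : Set V :=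
  {x | x ∈ T ∧ G.dist r x = G.dist r a + G.dist a x}

variable {G : SimpleGraph V} {r : V} {T : Set V}

lemma descendants_trans (hc : G.Connected) {a b x : V} (hb : b ∈ descendants G r T a)
    (hx : x ∈ descendants G r T b) : x ∈ descendants G r T a := by
  obtain ⟨hb, hb'⟩ := hb
  obtain ⟨hx, hx'⟩ := hx
  have h1 := hc.dist_triangle (u := a) (v := b) (w := x)
  have h2 := hc.dist_triangle (u := r) (v := a) (w := x)
  exact ⟨hx, by omega⟩

lemma mem_descendants_of_adj {a b : V} (hb : b ∈ T) (hab : G.Adj a b)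
    (h : G.dist r b = G.dist r a + 1) : b ∈ descendants G r T a :=
  ⟨hb, by rw [h, dist_eq_one_iff_adj.mpr hab]⟩

lemma three_le_degree [Fintype V] [DecidableRel G.Adj] {w a b c : V} (ha : G.Adj w a) (hb : G.Adj w b) (hc : G.Adj w c)
    (hab : a ≠ b) (hac : a ≠ c) (hbc : b ≠ c) : 3 ≤ G.degree w := by
  classical
  have h : ({a, b, c} : Finset V).card = 3 := Finset.card_eq_three.mpr
    ⟨a, b, c, hab, hac, hbc, rfl⟩
  rw [← h]
  refine Finset.card_le_card fun x hx => ?_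
  simp only [Finset.mem_insert, Finset.mem_singleton] at hx
  rcases hx with rfl | rfl | rfl <;> simpa

namespace HangingTree

lemma parent_mem_descendants (hT : HangingTree G r T) (hc : G.Connected) {a x y : V}
    (hx : x ∈ descendants G r T a) (hxr : x ≠ r) (hxa : x ≠ a) (hxy : G.Adj x y)
    (hy : G.dist r y ≤ G.dist r x) : y ∈ descendants G r T a := by
  obtain ⟨z, hxz, hz⟩ := exists_adj_dist_eq_add_one hc hxa
  obtain ⟨hxT, hx⟩ := hx
  have h1 := hc.dist_triangle (u := r) (v := a) (w := z)
  have h2 := dist_le_dist_add_one hc r hxz.symm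
  obtain rfl := hT.parent_unique x hxT hxr y z hxy hxz hy (by omega)
  exact ⟨hT.adj_mem x hxT hxr y hxy, by omega⟩

lemma dist_eq_add_of_mem_descendants (hT : HangingTree G r T) (hc : G.Connected) {a x y : V}
    (har : a ≠ r) (hx : x ∈ descendants G r T a) (hy : y ∉ descendants G r T a) :
    G.dist x y = G.dist x a + G.dist a y := by
  refine dist_eq_add_of_forall_adj_mem hc (fun u hu hua v huv => ?_) hx hy
  have hur : u ≠ r := by
    rintro rfl
    have := hu.2
    rw [dist_self] at this
    exact har.symm (hc.dist_eq_zero_iff.mp (by omega))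
  by_cases h : G.dist r v ≤ G.dist r u
  · exact hT.parent_mem_descendants hc hu hur hua huv h
  · refine descendants_trans hc hu (mem_descendants_of_adj (hT.adj_mem u hu.1 hur v huv) huv ?_)
    have := dist_le_dist_add_one hc r huv
    omega

/-- Every vertex of `T` other than the root descends from a child of the root. -/
lemma exists_root_child (hT : HangingTree G r T) (hc : G.Connected) {x : V} (hx : x ∈ T)
    (hxr : x ≠ r) : ∃ a ∈ T, a ≠ r ∧ G.Adj r a ∧ x ∈ descendants G r T a := by
  induction h : G.dist r x generalizing x with
  | zero => exact absurd (hc.dist_eq_zero_iff.mp h).symm hxr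
  | succ n ih =>
    obtain ⟨y, hxy, hy⟩ := exists_adj_dist_eq_add_one hc hxr
    by_cases hyr : y = r
    · subst hyr
      exact ⟨x, hx, hxr, hxy.symm, hx, by simp⟩
    · have hyT := hT.adj_mem x hx hxr y hxy
      obtain ⟨a, ha, har, hra, hya⟩ := ih hyT hyr (by omega)
      exact ⟨a, ha, har, hra, descendants_trans hc hya (mem_descendants_of_adj hx hxy.symm hy)⟩

/-- Two vertices at the same height descend from different children of a common ancestor. -/
lemma exists_branching (hT : HangingTree G r T) (hc : G.Connected) {u v : V} (hu : u ∈ T)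
    (hv : v ∈ T) (huv : u ≠ v) (h : G.dist r u = G.dist r v) :
    ∃ w ∈ T, ∃ a ∈ T, ∃ b ∈ T, a ≠ b ∧ G.Adj w a ∧ G.Adj w b ∧
      G.dist r a = G.dist r w + 1 ∧ G.dist r b = G.dist r w + 1 ∧
      u ∈ descendants G r T a ∧ v ∈ descendants G r T b ∧
      v ∉ descendants G r T a ∧ u ∉ descendants G r T b := by
  induction hn : G.dist r u generalizing u v with
  | zero =>
    have h1 := hc.dist_eq_zero_iff.mp hn
    have h2 := hc.dist_eq_zero_iff.mp (h ▸ hn)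
    exact absurd (h1.symm.trans h2) huv
  | succ n ih =>
    have hur : u ≠ r := by
      rintro rfl
      simp at hn
    have hvr : v ≠ r := by
      rintro rfl
      rw [dist_self] at h
      omega
    obtain ⟨u', huu', hu'⟩ := exists_adj_dist_eq_add_one hc hur
    obtain ⟨v', hvv', hv'⟩ := exists_adj_dist_eq_add_one hc hvr
    have hu'T := hT.adj_mem u hu hur u' huu'
    have hv'T := hT.adj_mem v hv hvr v' hvv'
    have hpos := hc.pos_dist_of_ne huv
    have hpos' := hc.pos_dist_of_ne huv.symm
    by_cases he : u' = v'
    · subst he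
      refine ⟨u', hu'T, u, hu, v, hv, huv, huu'.symm, hvv'.symm, hu', hv', ⟨hu, by simp⟩,
        ⟨hv, by simp⟩, fun h => ?_, fun h => ?_⟩
      · have := h.2
        omega
      · have := h.2
        omega
    · obtain ⟨w, hw, a, ha, b, hb, hab, hwa, hwb, hda, hdb, hua, hvb, hva, hub⟩ :=
        ih hu'T hv'T he (by omega) (by omega)
      refine ⟨w, hw, a, ha, b, hb, hab, hwa, hwb, hda, hdb,
        descendants_trans hc hua (mem_descendants_of_adj hu huu'.symm hu'),
        descendants_trans hc hvb (mem_descendants_of_adj hv hvv'.symm hv'),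
        fun h => hva ?_, fun h => hub ?_⟩
      · refine hT.parent_mem_descendants hc h hvr ?_ hvv' (by omega)
        rintro rfl
        have := hua.2
        omega
      · refine hT.parent_mem_descendants hc h hur ?_ huu' (by omega)
        rintro rfl
        have := hvb.2
        omega

/-- A descendant of `a` distinguishes another descendant of `a` from a non-descendant of the same
height. -/
lemma dist_ne_of_mem_descendants (hT : HangingTree G r T) (hc : G.Connected)
    {a s u v : V} (har : a ≠ r) (hs : s ∈ descendants G r T a) (hu : u ∈ descendants G r T a)
    (hv : v ∉ descendants G r T a) (hvT : v ∈ T) (h : G.dist r u = G.dist r v) :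
    G.dist s u ≠ G.dist s v := by
  have h1 := hT.dist_eq_add_of_mem_descendants hc har hs hv
  have h2 := hc.dist_triangle (u := s) (v := a) (w := u)
  have h3 := hc.dist_triangle (u := r) (v := a) (w := v)
  have h4 := hu.2
  intro h5
  exact hv ⟨hvT, by omega⟩

variable [Fintype V] [DecidableEq V] [DecidableRel G.Adj]

/-- The descendants of a vertex avoiding a branch-resolving set form a thread at its parent. -/
lemma exists_path_of_disjoint (hT : HangingTree G r T) (hc : G.Connected) {S : Set V}
    (hbr : BranchResolving G S) {w a : V} (ha : a ∈ T) (hwa : G.Adj w a)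
    (hda : G.dist r a = G.dist r w + 1) (hS : ∀ s ∈ descendants G r T a, s ∉ S) :
    ∃ t : List V, t.head? = some a ∧ t.Nodup ∧ w ∉ t ∧ List.IsChain G.Adj t ∧
      (∀ u ∈ t.getLast?, G.degree u = 1) ∧ (∀ u ∈ t.dropLast, G.degree u = 2) ∧
      (∀ x ∈ t, x ∈ descendants G r T a) ∧
      ∀ x ∈ descendants G r T a, G.dist a x + 1 ≤ t.length := by
  obtain ⟨N, hN⟩ : ∃ N, ∀ x, G.dist r x < G.dist r a + N := by
    obtain ⟨M, hM⟩ := (Set.finite_range (G.dist r)).bddAbove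
    refine ⟨M + 1, fun x => ?_⟩
    have := hM ⟨x, rfl⟩
    omega
  induction N generalizing w a with
  | zero => exact absurd (hN a) (by omega)
  | succ N ih =>
    have har : a ≠ r := by
      rintro rfl
      simp at hda
    have hchild : ∀ y, G.Adj a y → y ≠ w → y ∈ T ∧ G.dist r y = G.dist r a + 1 := by
      intro y hay hyw
      refine ⟨hT.adj_mem a ha har y hay, ?_⟩
      have h1 := dist_le_dist_add_one hc r hay
      by_contra h
      exact hyw (hT.parent_unique a ha har y w hay hwa.symm (by omega) (by omega))
    have hrec : ∀ y, G.Adj a y → y ≠ w → _ := fun y hay hyw =>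
      ih (hchild y hay hyw).1 hay (hchild y hay hyw).2
        (fun s hs => hS s (descendants_trans hc
          (mem_descendants_of_adj (hchild y hay hyw).1 hay (hchild y hay hyw).2) hs))
        (fun x => by
          have := hN x
          have := (hchild y hay hyw).2
          omega)
    have hdeg : G.degree a = ((G.neighborFinset a).erase w).card + 1 := by
      rw [Finset.card_erase_add_one (by simpa using hwa.symm), card_neighborFinset_eq_degree]
    have hself : a ∈ descendants G r T a := ⟨ha, by simp⟩
    have hmem : ∀ y, y ∈ (G.neighborFinset a).erase w ↔ G.Adj a y ∧ y ≠ w := fun y => by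
      simp [and_comm]
    rcases Nat.lt_trichotomy ((G.neighborFinset a).erase w).card 1 with h0 | h1 | h2
    · have h0' := Finset.card_eq_zero.mp (by omega : ((G.neighborFinset a).erase w).card = 0)
      refine ⟨[a], rfl, by simp, by simpa using hwa.ne, by simp, by simp; omega, by simp,
        by simpa using hself, fun x hx => ?_⟩
      by_cases hxa : x = a
      · simp [hxa]
      · obtain ⟨b, hab, hb⟩ := exists_adj_dist_eq_one_add hc hxa
        have hbw : b ≠ w := by
          rintro rfl
          have := hx.2
          have := hc.dist_triangle (u := r) (v := b) (w := x)
          omega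
        have := (hmem b).mpr ⟨hab, hbw⟩
        simp [h0'] at this
    · obtain ⟨b, hb⟩ := Finset.card_eq_one.mp h1
      have hb' := (hmem b).mp (by simp [hb])
      have hdb := (hchild b hb'.1 hb'.2)
      obtain ⟨t, ht, hnd, hat, hch, hlast, hdrop, hsub, hlen⟩ := hrec b hb'.1 hb'.2
      obtain ⟨t', rfl⟩ : ∃ t', t = b :: t' := by
        cases t with
        | nil => simp at ht
        | cons c t' =>
          simp at ht
          exact ⟨t', by rw [ht]⟩
      have hsub' : ∀ x ∈ a :: b :: t', x ∈ descendants G r T a := by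
        intro x hx
        rcases List.mem_cons.mp hx with rfl | hx
        · exact hself
        · exact descendants_trans hc (mem_descendants_of_adj hdb.1 hb'.1 hdb.2) (hsub x hx)
      refine ⟨a :: b :: t', rfl, List.nodup_cons.mpr ⟨hat, hnd⟩, fun h => ?_,
        List.isChain_cons_cons.mpr ⟨hb'.1, hch⟩, by simpa using hlast, fun u hu => ?_, hsub',
        fun x hx => ?_⟩
      · have := (hsub' w h).2
        omega
      · rw [List.dropLast_cons_cons, List.mem_cons] at hu
        rcases hu with rfl | hu
        · omega
        · exact hdrop u hu
      · by_cases hxa : x = a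
        · simp [hxa]
        · obtain ⟨c, hac, hcx⟩ := exists_adj_dist_eq_one_add hc hxa
          have hcw : c ≠ w := by
            rintro rfl
            have := hx.2
            have := hc.dist_triangle (u := r) (v := c) (w := x)
            omega
          have hcb : c = b := by
            have := (hmem c).mpr ⟨hac, hcw⟩
            simpa [hb] using this
          subst hcb
          have := hlen x ⟨hx.1, by have := hx.2; omega⟩
          rw [List.length_cons]
          omega
    · obtain ⟨b, hb, c, hc', hbc⟩ := Finset.one_lt_card.mp h2
      rw [hmem] at hb hc'
      obtain ⟨t₁, ht₁, hnd₁, hat₁, hch₁, hlast₁, hdrop₁, hsub₁, -⟩ := hrec b hb.1 hb.2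
      obtain ⟨t₂, ht₂, hnd₂, hat₂, hch₂, hlast₂, hdrop₂, hsub₂, -⟩ := hrec c hc'.1 hc'.2
      have hthread : ∀ t : List V, ∀ y, G.Adj a y → t.head? = some y → t.Nodup → a ∉ t →
          List.IsChain G.Adj t → (∀ u ∈ t.getLast?, G.degree u = 1) →
          (∀ u ∈ t.dropLast, G.degree u = 2) → IsThreadAt G a t := by
        intro t y hay hty h1 h2 h3 h4 h5
        refine ⟨?_, h1, h2, by omega, h3, ?_, h4, h5⟩
        · rintro rfl
          simp at hty
        · intro u hu
          rw [hty] at hu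
          obtain rfl : y = u := by simpa using hu
          exact hay
      have key := hbr a t₁ t₂ (hthread t₁ b hb.1 ht₁ hnd₁ hat₁ hch₁ hlast₁ hdrop₁)
        (hthread t₂ c hc'.1 ht₂ hnd₂ hat₂ hch₂ hlast₂ hdrop₂) (by
          rintro rfl
          rw [ht₁] at ht₂
          exact hbc (by simpa using ht₂))
      have hdb := (hchild b hb.1 hb.2)
      have hdc := (hchild c hc'.1 hc'.2)
      rcases key with ⟨s, hs, hst⟩ | ⟨s, hs, hst⟩
      · exact absurd hs (hS s (descendants_trans hc (mem_descendants_of_adj hdb.1 hb.1 hdb.2)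
          (hsub₁ s hst)))
      · exact absurd hs (hS s (descendants_trans hc (mem_descendants_of_adj hdc.1 hc'.1 hdc.2)
          (hsub₂ s hst)))

lemma exists_thread_of_disjoint (hT : HangingTree G r T) (hc : G.Connected) {S : Set V}
    (hbr : BranchResolving G S) {w a : V} (hw : 3 ≤ G.degree w) (ha : a ∈ T) (hwa : G.Adj w a)
    (hda : G.dist r a = G.dist r w + 1) (hS : ∀ s ∈ descendants G r T a, s ∉ S) :
    ∃ t : List V, IsThreadAt G w t ∧ SFree S t ∧ t.head? = some a ∧
      ∀ x ∈ descendants G r T a, G.dist a x + 1 ≤ t.length := by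
  obtain ⟨t, ht, hnd, hwt, hch, hlast, hdrop, hsub, hlen⟩ :=
    hT.exists_path_of_disjoint hc hbr ha hwa hda hS
  refine ⟨t, ⟨?_, hnd, hwt, hw, hch, ?_, hlast, hdrop⟩, fun x hx => hS x (hsub x hx), ht, hlen⟩
  · rintro rfl
    simp at ht
  · intro u hu
    rw [ht] at hu
    obtain rfl : a = u := by simpa using hu
    exact hwa

/-- Two vertices of `T` at the same height are distinguished by any branch-resolving set. -/
lemma exists_dist_ne_of_dist_eq (hT : HangingTree G r T) (hc : G.Connected) {S : Set V}
    (hbr : BranchResolving G S) {u v : V} (hu : u ∈ T) (hv : v ∈ T) (huv : u ≠ v)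
    (h : G.dist r u = G.dist r v) : ∃ s ∈ S, G.dist s u ≠ G.dist s v := by
  by_contra! hcon
  obtain ⟨w, hw, a, ha, b, hb, hab, hwa, hwb, hda, hdb, hua, hvb, hva, hub⟩ :=
    hT.exists_branching hc hu hv huv h
  have har : a ≠ r := by
    rintro rfl
    simp at hda
  have hbr' : b ≠ r := by
    rintro rfl
    simp at hdb
  have hdeg : 3 ≤ G.degree w := by
    by_cases hwr : w = r
    · subst hwr
      obtain ⟨y, z, hyz, hy, hz, hry, hrz⟩ := hT.root_adj
      exact three_le_degree hwa hry hrz (fun h => hy (h ▸ ha)) (fun h => hz (h ▸ ha)) hyz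
    · obtain ⟨y, hwy, hy⟩ := exists_adj_dist_eq_add_one hc hwr
      refine three_le_degree hwa hwb hwy hab ?_ ?_
      · rintro rfl
        omega
      · rintro rfl
        omega
  obtain ⟨t₁, ht₁, hS₁, hh₁, -⟩ := hT.exists_thread_of_disjoint hc hbr hdeg ha hwa hda
    fun s hs hsS => hT.dist_ne_of_mem_descendants hc har hs hua hva hv h (hcon s hsS)
  obtain ⟨t₂, ht₂, hS₂, hh₂, -⟩ := hT.exists_thread_of_disjoint hc hbr hdeg hb hwb hdb
    fun s hs hsS => hT.dist_ne_of_mem_descendants hc hbr' hs hvb hub hu h.symm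
      (hcon s hsS).symm
  rcases hbr w t₁ t₂ ht₁ ht₂ (by
    rintro rfl
    rw [hh₁] at hh₂
    exact hab (by simpa using hh₂)) with ⟨s, hs, hst⟩ | ⟨s, hs, hst⟩
  · exact hS₁ s hst hs
  · exact hS₂ s hst hs

/-- If no vertex of a branch-resolving set lies in the branch of `u` at the root, then this
branch is a thread. -/
lemma exists_root_thread (hT : HangingTree G r T) (hc : G.Connected) {S : Set V}
    (hbr : BranchResolving G S) {u : V} (hu : u ∈ T) (hur : u ≠ r)
    (h : ∀ s ∈ S, s ∈ T → G.dist r s + G.dist r u ≤ G.dist s u) :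
    ∃ t : List V, IsThreadAt G r t ∧ SFree S t ∧ G.dist r u ≤ t.length := by
  obtain ⟨a, ha, har, hra, hua⟩ := hT.exists_root_child hc hu hur
  have h1 : G.dist r a = 1 := dist_eq_one_iff_adj.mpr hra
  obtain ⟨y, z, hyz, hy, hz, hry, hrz⟩ := hT.root_adj
  obtain ⟨t, ht, hS, -, hlen⟩ := hT.exists_thread_of_disjoint hc hbr
    (three_le_degree hra hry hrz (fun h => hy (h ▸ ha)) (fun h => hz (h ▸ ha)) hyz) ha hra
    (by simpa using h1) fun s hs hsS => by
      have h2 := h s hsS hs.1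
      have h3 := hc.dist_triangle (u := s) (v := a) (w := u)
      rw [dist_comm (u := s) (v := a)] at h3
      have := hs.2
      have := hua.2
      omega
  refine ⟨t, ht, hS, ?_⟩
  have := hlen u hua
  have := hua.2
  omega

end HangingTree

end HangingTree

section Cycle

variable {V : Type*} {G : SimpleGraph V} {g : ℕ} {vc : ZMod g → V}

/-- The cycle vertices stay connected after removal of one edge of the cycle. -/
lemma reachable_of_forall_ne [NeZero g] {H : SimpleGraph V} {i : ZMod g}
    (h : ∀ m, m ≠ i → H.Adj (vc m) (vc (m + 1))) (a b : ZMod g) :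
    H.Reachable (vc a) (vc b) := by
  have key : ∀ n : ℕ, n < g → H.Reachable (vc (i + 1)) (vc (i + 1 + n)) := by
    intro n
    induction n with
    | zero => simp
    | succ n ih =>
      intro hn
      have hne : i + 1 + (n : ZMod g) ≠ i := by
        intro h
        have h0 : ((n + 1 : ℕ) : ZMod g) = 0 := by
          push_cast
          linear_combination h
        rw [ZMod.natCast_eq_zero_iff] at h0
        exact absurd (Nat.le_of_dvd (by omega) h0) (by omega)
      have := (ih (by omega)).trans (h _ hne).reachable
      rwa [add_assoc (i + 1), ← Nat.cast_succ] at this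
  have key' : ∀ a, H.Reachable (vc (i + 1)) (vc a) := by
    intro a
    have := key (a - (i + 1)).val (ZMod.val_lt _)
    simpa using this
  exact (key' a).symm.trans (key' b)

lemma ZMod.natCast_ne_zero_of_lt {n : ℕ} (h : n ≠ 0) (hn : n < g) : (n : ZMod g) ≠ 0 := by
  rw [Ne, ZMod.natCast_eq_zero_iff]
  exact fun hd => absurd (Nat.le_of_dvd (by omega) hd) (by omega)

lemma cycle_edge_injective (hg : 3 ≤ g) (hvc : IsCycleLabelling G g vc) {i j : ZMod g}
    (h : s(vc i, vc (i + 1)) = s(vc j, vc (j + 1))) : i = j := by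
  rw [Sym2.eq_iff] at h
  rcases h with ⟨h, -⟩ | ⟨h1, h2⟩
  · exact hvc.1 h
  · have h1 := hvc.1 h1
    have h2 := hvc.1 h2
    refine absurd ?_ (ZMod.natCast_ne_zero_of_lt (g := g) (n := 2) (by omega) (by omega))
    push_cast
    linear_combination h2 - h1

/-- In a unicyclic graph every cycle consists of edges of the labelled cycle. -/
lemma mem_cycleEdges_of_isCycle (hG : IsUnicyclic G) (hg : 3 ≤ g)
    (hvc : IsCycleLabelling G g vc) {u : V} {w : G.Walk u u} (hw : w.IsCycle) {e : Sym2 V}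
    (he : e ∈ w.edges) : e ∈ cycleEdges g vc := by
  have : NeZero g := ⟨by omega⟩
  set H := SimpleGraph.fromEdgeSet (cycleEdges g vc) with hH
  have hadj : ∀ i, H.Adj (vc i) (vc (i + 1)) := fun i => by
    rw [hH, fromEdgeSet_adj]
    exact ⟨⟨i, rfl⟩, (hvc.2 i).ne⟩
  have hle : H ≤ G := by
    intro x y hxy
    rw [hH, fromEdgeSet_adj] at hxy
    obtain ⟨i, hi⟩ := hxy.1
    have := hvc.2 i
    rwa [← mem_edgeSet, ← hi] at this
  obtain ⟨x, p, hp, -⟩ := adj_and_reachable_delete_edges_iff_exists_cycle.mp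
    ⟨hadj 0, reachable_of_forall_ne (vc := vc) (i := 0) (fun m hm => by
      rw [deleteEdges_adj]
      exact ⟨hadj m, fun h => hm (cycle_edge_injective hg hvc h)⟩) _ _⟩
  have h := (hG.2.2 _ _ w (p.mapLe hle) hw (hp.mapLe hle) e).mp he
  rw [Walk.edges_mapLe_eq_edges] at h
  have := p.edges_subset_edgeSet h
  rw [hH, edgeSet_fromEdgeSet] at this
  exact this.1

lemma mem_cycleEdges_of_reachable (hG : IsUnicyclic G) (hg : 3 ≤ g)
    (hvc : IsCycleLabelling G g vc) {x y : V} (hxy : G.Adj x y)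
    (h : (G.deleteEdges {s(x, y)}).Reachable x y) : s(x, y) ∈ cycleEdges g vc := by
  obtain ⟨u, p, hp, he⟩ := adj_and_reachable_delete_edges_iff_exists_cycle.mp ⟨hxy, h⟩
  exact mem_cycleEdges_of_isCycle hG hg hvc hp he

/-- Distinct cycle vertices lie in distinct components of `G - E(C)`. -/
lemma eq_of_offCycle_reachable (hG : IsUnicyclic G) (hg : 3 ≤ g)
    (hvc : IsCycleLabelling G g vc) {i j : ZMod g}
    (h : (offCycle G g vc).Reachable (vc i) (vc j)) : i = j := by
  classical
  have : NeZero g := ⟨by omega⟩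
  by_contra hij
  obtain ⟨p, hp⟩ := h.exists_isPath
  generalize hx : vc i = x at p hp
  generalize hz : vc j = z at p hp
  cases p with
  | nil => exact hij (hvc.1 (hx.trans hz.symm))
  | @cons _ y _ hxy q =>
    rw [Walk.cons_isPath_iff] at hp
    have hxy' := hxy
    rw [offCycle, deleteEdges_adj] at hxy'
    refine hxy'.2 (mem_cycleEdges_of_reachable hG hg hvc hxy'.1 ?_)
    have h1 : (G.deleteEdges {s(x, y)}).Reachable x z := by
      rw [← hx, ← hz]
      refine reachable_of_forall_ne (i := 0) (fun m _ => ?_) _ _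
      rw [deleteEdges_adj]
      refine ⟨hvc.2 m, fun h => hxy'.2 ?_⟩
      rw [← hx, ← Set.mem_singleton_iff.mp h]
      exact ⟨m, rfl⟩
    have h2 : (G.deleteEdges {s(x, y)}).Reachable y z := by
      refine ⟨q.transfer _ fun e he => ?_⟩
      have := q.edges_subset_edgeSet he
      rw [offCycle, edgeSet_deleteEdges] at this
      rw [edgeSet_deleteEdges]
      refine ⟨this.1, fun h => hp.2 ?_⟩
      rw [Set.mem_singleton_iff.mp h] at he
      exact q.fst_mem_support_of_mem_edges he
    exact h1.trans h2.symm

lemma exists_inTree (hc : G.Connected) (x : V) : ∃ i, inTree G g vc i x := by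
  obtain ⟨p⟩ := hc (vc 0) x
  suffices h : ∀ y z (q : G.Walk y z), (∃ i, inTree G g vc i y) → ∃ i, inTree G g vc i z from
    h _ _ p ⟨0, Reachable.refl _⟩
  intro y z q
  induction q with
  | nil => exact id
  | @cons a b c hab q ih =>
    rintro ⟨i, hi⟩
    refine ih ?_
    by_cases he : s(a, b) ∈ cycleEdges g vc
    · obtain ⟨j, hj⟩ := he
      rcases Sym2.eq_iff.mp hj with ⟨-, rfl⟩ | ⟨-, rfl⟩
      · exact ⟨_, Reachable.refl _⟩
      · exact ⟨_, Reachable.refl _⟩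
    · refine ⟨i, Reachable.trans hi (Adj.reachable ?_)⟩
      rw [offCycle, deleteEdges_adj]
      exact ⟨hab, he⟩

lemma inTree_unique (hG : IsUnicyclic G) (hg : 3 ≤ g) (hvc : IsCycleLabelling G g vc)
    {i j : ZMod g} {x : V} (hi : inTree G g vc i x) (hj : inTree G g vc j x) : i = j :=
  eq_of_offCycle_reachable hG hg hvc (Reachable.trans hi (Reachable.symm hj))

/-- An edge leaving a tree `T_{v_i}` is an edge of the cycle. -/
lemma inTree_of_adj {i : ZMod g} {x y : V} (hx : inTree G g vc i x) (hxy : G.Adj x y) :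
    inTree G g vc i y ∨ s(x, y) ∈ cycleEdges g vc := by
  by_cases he : s(x, y) ∈ cycleEdges g vc
  · exact Or.inr he
  · refine Or.inl (Reachable.trans hx (Adj.reachable ?_))
    rw [offCycle, deleteEdges_adj]
    exact ⟨hxy, he⟩

lemma notMem_cycleEdges (hG : IsUnicyclic G) (hg : 3 ≤ g) (hvc : IsCycleLabelling G g vc)
    {i : ZMod g} {x : V} (hx : inTree G g vc i x) (hxi : x ≠ vc i) (y : V) :
    s(x, y) ∉ cycleEdges g vc := by
  rintro ⟨j, hj⟩
  rcases Sym2.eq_iff.mp hj with ⟨rfl, -⟩ | ⟨rfl, -⟩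
  · exact hxi (congrArg vc (eq_of_offCycle_reachable hG hg hvc hx).symm)
  · exact hxi (congrArg vc (eq_of_offCycle_reachable hG hg hvc hx).symm)

lemma exists_walk_notMem_support (hc : G.Connected) {r x y : V} (hxy : G.Adj x y)
    (h : G.dist r y ≤ G.dist r x) : ∃ p : G.Walk r y, x ∉ p.support := by
  classical
  obtain ⟨p, hp⟩ := hc.exists_walk_length_eq_dist r y
  refine ⟨p, fun hx => ?_⟩
  have h1 := congrArg Walk.length (p.take_spec hx)
  rw [Walk.length_append] at h1
  have h2 := dist_le (p.takeUntil x hx)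
  have h3 := dist_le (p.dropUntil x hx)
  rw [dist_eq_one_iff_adj.mpr hxy] at h3
  omega

lemma hangingTree_inTree (hG : IsUnicyclic G) (hg : 3 ≤ g) (hvc : IsCycleLabelling G g vc)
    (i : ZMod g) : HangingTree G (vc i) {x | inTree G g vc i x} where
  adj_mem x hx hxi y hxy := by
    rcases inTree_of_adj hx hxy with h | h
    · exact h
    · exact absurd h (notMem_cycleEdges hG hg hvc hx hxi y)
  parent_unique x hx hxi y z hxy hxz hy hz := by
    by_contra hyz
    refine notMem_cycleEdges hG hg hvc hx hxi y (mem_cycleEdges_of_reachable hG hg hvc hxy ?_)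
    obtain ⟨p, hp⟩ := exists_walk_notMem_support hG.1 hxy hy
    obtain ⟨q, hq⟩ := exists_walk_notMem_support hG.1 hxz hz
    have hdel : ∀ {a b : V} (w : G.Walk a b), x ∉ w.support →
        (G.deleteEdges {s(x, y)}).Reachable a b := by
      intro a b w hw
      refine ⟨w.toDeleteEdges _ fun e he h => hw ?_⟩
      rw [Set.mem_singleton_iff.mp h] at he
      exact w.fst_mem_support_of_mem_edges he
    have hxz' : (G.deleteEdges {s(x, y)}).Adj x z := by
      rw [deleteEdges_adj]
      refine ⟨hxz, fun h => hyz ?_⟩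
      have := Sym2.eq_iff.mp (Set.mem_singleton_iff.mp h)
      rcases this with ⟨-, h⟩ | ⟨h, -⟩
      · exact h.symm
      · exact absurd h hxy.ne
    exact hxz'.reachable.trans ((hdel q hq).symm.trans (hdel p hp))
  root_adj := by
    have h1 := ZMod.natCast_ne_zero_of_lt (g := g) (n := 1) (by omega) (by omega)
    have h2 := ZMod.natCast_ne_zero_of_lt (g := g) (n := 2) (by omega) (by omega)
    push_cast at h1 h2
    refine ⟨vc (i + 1), vc (i - 1), fun h => h2 ?_, fun h => h1 ?_, fun h => h1 ?_, hvc.2 i, ?_⟩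
    · linear_combination hvc.1 h
    · linear_combination -eq_of_offCycle_reachable hG hg hvc h
    · linear_combination eq_of_offCycle_reachable hG hg hvc h
    · have := hvc.2 (i - 1)
      rw [sub_add_cancel] at this
      exact this.symm

/-- The distance of the vertices with indices `a` and `b` on a cycle of length `g`. -/
def cyclicDist (g a b : ℕ) : ℕ := min (max a b - min a b) (g - (max a b - min a b))

lemma dist_vc_add_le (hc : G.Connected) (hvc : IsCycleLabelling G g vc) (i : ZMod g) (n : ℕ) :
    G.dist (vc i) (vc (i + n)) ≤ n := by
  induction n with
  | zero => simp
  | succ n ih =>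
    have := dist_le_dist_add_one hc (vc i) (hvc.2 (i + n))
    rw [add_assoc, ← Nat.cast_add_one] at this
    omega

lemma dist_vc_le_cyclicDist (hc : G.Connected) (hvc : IsCycleLabelling G g vc) {a b : ℕ}
    (ha : a < g) (hb : b < g) : G.dist (vc a) (vc b) ≤ cyclicDist g a b := by
  wlog hab : a ≤ b generalizing a b
  · have := this hb ha (by omega)
    rw [dist_comm]
    unfold cyclicDist at *
    omega
  have h1 := dist_vc_add_le hc hvc (a : ZMod g) (b - a)
  have h2 := dist_vc_add_le hc hvc (b : ZMod g) (g - (b - a))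
  rw [← Nat.cast_add] at h1 h2
  rw [show a + (b - a) = b by omega] at h1
  rw [show b + (g - (b - a)) = a + g by omega, Nat.cast_add, ZMod.natCast_self, add_zero,
    dist_comm] at h2
  unfold cyclicDist
  omega

/-- `P` assigns to every vertex the index of the tree `T_{v_i}` that contains it. -/
lemma exists_index (hG : IsUnicyclic G) (hg : 3 ≤ g) (hvc : IsCycleLabelling G g vc) :
    ∃ P : V → ℕ, (∀ x, P x < g) ∧ (∀ x n, n < g → (inTree G g vc (n : ZMod g) x ↔ P x = n)) ∧
      (∀ n, n < g → P (vc (n : ZMod g)) = n) ∧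
      ∀ a < g, ∀ x y, G.Adj x y → cyclicDist g a (P y) ≤ cyclicDist g a (P x) + 1 := by
  have : NeZero g := ⟨by omega⟩
  choose p hp using fun x : V => exists_inTree (vc := vc) hG.1 x
  have hpu : ∀ i x, inTree G g vc i x → p x = i := fun i x h => inTree_unique hG hg hvc (hp x) h
  have hpvc : ∀ i, p (vc i) = i := fun i => hpu i _ (Reachable.refl _)
  have hsucc : ∀ (a : ℕ) (i : ZMod g), a < g →
      cyclicDist g a (i + 1).val ≤ cyclicDist g a i.val + 1 ∧
      cyclicDist g a i.val ≤ cyclicDist g a (i + 1).val + 1 := by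
    intro a i ha
    have hi := ZMod.val_lt i
    have h1 : (1 : ZMod g).val = 1 := ZMod.val_one'' (by omega)
    have := ZMod.val_add i 1
    rw [h1] at this
    rcases Nat.lt_or_ge (i.val + 1) g with h | h
    · rw [Nat.mod_eq_of_lt h] at this
      unfold cyclicDist
      omega
    · rw [show i.val + 1 = g by omega, Nat.mod_self] at this
      unfold cyclicDist
      omega
  refine ⟨fun x => (p x).val, fun x => ZMod.val_lt _, fun x n hn => ?_, fun n hn => ?_,
    fun a ha x y hxy => ?_⟩
  · dsimp only
    refine ⟨fun h => ?_, fun h => ?_⟩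
    · rw [hpu _ _ h, ZMod.val_natCast_of_lt hn]
    · have := hp x
      rwa [← ZMod.natCast_zmod_val (p x), h] at this
  · dsimp only
    rw [hpvc, ZMod.val_natCast_of_lt hn]
  · rcases inTree_of_adj (hp x) hxy with h | ⟨i, hi⟩
    · dsimp only
      rw [hpu _ _ h]
      omega
    · dsimp only
      rcases Sym2.eq_iff.mp hi with ⟨rfl, rfl⟩ | ⟨rfl, rfl⟩
      · rw [hpvc, hpvc]
        exact (hsucc a i ha).1
      · rw [hpvc, hpvc]
        exact (hsucc a i ha).2

lemma dist_vc_eq_cyclicDist (hG : IsUnicyclic G) (hg : 3 ≤ g) (hvc : IsCycleLabelling G g vc)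
    {a b : ℕ} (ha : a < g) (hb : b < g) : G.dist (vc a) (vc b) = cyclicDist g a b := by
  refine le_antisymm (dist_vc_le_cyclicDist hG.1 hvc ha hb) ?_
  obtain ⟨P, -, -, hP, hadj⟩ := exists_index hG hg hvc
  have := le_add_dist_of_adj hG.1 (fun x => cyclicDist g a (P x)) (hadj a ha) (vc a) (vc b)
  rw [hP a ha, hP b hb] at this
  have h0 : cyclicDist g a a = 0 := by simp [cyclicDist]
  omega

/-- The distance of vertices in different trees `T_{v_i}`. -/
lemma dist_eq_of_inTree (hG : IsUnicyclic G) (hg : 3 ≤ g) (hvc : IsCycleLabelling G g vc)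
    {a b : ℕ} (ha : a < g) (hb : b < g) (hab : a ≠ b) {x y : V}
    (hx : inTree G g vc (a : ZMod g) x) (hy : inTree G g vc (b : ZMod g) y) :
    G.dist x y = G.dist (vc a) x + cyclicDist g a b + G.dist (vc b) y := by
  have hne : (a : ZMod g) ≠ b := by
    intro h
    have := congrArg ZMod.val h
    rw [ZMod.val_natCast_of_lt ha, ZMod.val_natCast_of_lt hb] at this
    exact hab this
  have h1 := dist_eq_add_of_forall_adj_mem hG.1 (hangingTree_inTree hG hg hvc a).adj_mem hx
    (y := y) fun h => hne (inTree_unique hG hg hvc h hy)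
  have h2 := dist_eq_add_of_forall_adj_mem hG.1 (hangingTree_inTree hG hg hvc b).adj_mem hy
    (y := vc a) fun h => hne (eq_of_offCycle_reachable hG hg hvc h).symm
  have h3 := dist_vc_eq_cyclicDist hG hg hvc ha hb
  rw [dist_comm (u := y), dist_comm (u := y), dist_comm (u := vc b) (v := vc a)] at h2
  rw [dist_comm (u := x) (v := vc a)] at h1
  omega

end Cycle

section CyclicDist

lemma cyclicDist_spec {g a b : ℕ} (ha : a < g) (hb : b < g) :
    2 * cyclicDist g a b ≤ g ∧ (a + cyclicDist g a b = b ∨ b + cyclicDist g a b = a ∨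
      a + cyclicDist g a b = b + g ∨ b + cyclicDist g a b = a + g) := by
  unfold cyclicDist
  omega

/-- Given `i` and `j`, the equation `d(l, j) = d(l, i) + D` with `D < d(i, j)` determines `2 * l` up
to two values modulo `2 * g`. -/
lemma two_mul_eq_of_cyclicDist_eq {g i j D l : ℕ} (hi : i < g) (hj : j < g) (hl : l < g)
    (hlt : D < cyclicDist g i j) (h : cyclicDist g l j = cyclicDist g l i + D) :
    i < j ∧ (i + j = 2 * l + D ∨ i + j + D + g = 2 * l ∨ i + j + D = 2 * l + g) ∨
      j < i ∧ (i + j + D = 2 * l ∨ i + j + g = 2 * l + D ∨ i + j = 2 * l + D + g) := by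
  have s1 := cyclicDist_spec hi hj
  have s2 := cyclicDist_spec hl hi
  have s3 := cyclicDist_spec hl hj
  generalize cyclicDist g i j = e at *
  generalize cyclicDist g l i = x at *
  generalize cyclicDist g l j = y at *
  obtain ⟨s1, t1⟩ := s1
  obtain ⟨s2, t2⟩ := s2
  obtain ⟨s3, t3⟩ := s3
  rcases t1 with t1 | t1 | t1 | t1 <;> rcases t2 with t2 | t2 | t2 | t2 <;>
    rcases t3 with t3 | t3 | t3 | t3 <;> omega

lemma mem_arc_of_cyclicDist_eq {g i j l : ℕ} (hi : i < g) (hj : j < g) (hl : l < g)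
    (h : cyclicDist g l j = cyclicDist g l i + cyclicDist g i j) :
    (i + cyclicDist g i j = j ∨ i + cyclicDist g i j = j + g) ∧
        (l ≤ i ∧ i ≤ l + (g / 2 - cyclicDist g i j) ∨
          i + g ≤ l + (g / 2 - cyclicDist g i j)) ∨
      (j + cyclicDist g i j = i ∨ j + cyclicDist g i j = i + g) ∧
        (i ≤ l ∧ l ≤ i + (g / 2 - cyclicDist g i j) ∨
          l + g ≤ i + (g / 2 - cyclicDist g i j)) := by
  have s1 := cyclicDist_spec hi hj
  have s2 := cyclicDist_spec hl hi
  have s3 := cyclicDist_spec hl hj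
  generalize cyclicDist g i j = e at *
  generalize cyclicDist g l i = x at *
  generalize cyclicDist g l j = y at *
  obtain ⟨s1, t1⟩ := s1
  obtain ⟨s2, t2⟩ := s2
  obtain ⟨s3, t3⟩ := s3
  rcases t1 with t1 | t1 | t1 | t1 <;> rcases t2 with t2 | t2 | t2 | t2 <;>
    rcases t3 with t3 | t3 | t3 | t3 <;> omega

variable {g k i j D : ℕ} {A : ℕ → Prop}

/-- If `i` lies on geodesics from all elements of `A` to `j`, then `A` is contained in a short arc
and `i` lies outside of its interior. -/
lemma index_mem_of_cyclicDist_eq_add (hk : k < g) (hk0 : 0 < k) (hi : i < g) (hj : j < g)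
    (hij : i ≠ j) (h0 : A 0) (hAk : A k)
    (hA : ∀ l < g, A l → cyclicDist g l j = cyclicDist g l i + cyclicDist g i j)
    (harc : ∀ b m, b < g → (∀ a < g, A a → (b ≤ a ∧ a - b ≤ m) ∨ (a < b ∧ a + g - b ≤ m)) →
      k ≤ m) :
    k ≤ g / 2 - 1 ∧
      ((k ≤ i ∧ i ≤ g / 2 - 1) ∨ ((g + 1) / 2 + k + 1 ≤ i ∧ i ≤ g - 1) ∨ i = 0) := by
  have hmem := fun l hl hAl => mem_arc_of_cyclicDist_eq hi hj hl (hA l hl hAl)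
  have h0' := hmem 0 (by omega) h0
  have hk' := hmem k hk hAk
  have hs := cyclicDist_spec hi hj
  generalize cyclicDist g i j = e at *
  have key : k ≤ g / 2 - e := by
    by_cases hside : i + e = j ∨ i + e = j + g
    · by_cases hle : g / 2 - e ≤ i
      · refine harc (i - (g / 2 - e)) _ (by omega) fun a ha hAa => ?_
        have := hmem a ha hAa
        omega
      · refine harc (i + g - (g / 2 - e)) _ (by omega) fun a ha hAa => ?_
        have := hmem a ha hAa
        omega
    · refine harc i _ hi fun a ha hAa => ?_
      have := hmem a ha hAa
      omega
  clear hmem harc hA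
  omega

/-- If neither `i` nor `j` lies on geodesics between `A` and the other vertex, then `A` consists of
two elements, at distance `g / 2 - D`. -/
lemma pair_of_cyclicDist_eq_add (hk : k < g) (hk0 : 0 < k) (hi : i < g) (hj : j < g)
    (h0 : A 0) (hAk : A k) (hD : D < cyclicDist g i j)
    (hA : ∀ l < g, A l → cyclicDist g l j = cyclicDist g l i + D)
    (harc : ∀ b m, b < g → (∀ a < g, A a → (b ≤ a ∧ a - b ≤ m) ∨ (a < b ∧ a + g - b ≤ m)) →
      k ≤ m) :
    (∀ l < g, A l → l = 0 ∨ l = k) ∧ Even g ∧ k + D = g / 2 ∧ (D = 0 ∨ i ≤ k) := by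
  have hmem := fun l hl hAl => two_mul_eq_of_cyclicDist_eq hi hj hl hD (hA l hl hAl)
  have h0' := hmem 0 (by omega) h0
  have hk' := hmem k hk hAk
  have hpair : ∀ l < g, A l → l = 0 ∨ l = k := fun l hl hAl => by
    have := hmem l hl hAl
    omega
  have hkg : k ≤ g - k := by
    refine harc k _ hk fun a ha hAa => ?_
    have := hpair a ha hAa
    omega
  have hs := cyclicDist_spec hi hj
  have e0 := hA 0 (by omega) h0
  have s1 := cyclicDist_spec (by omega : 0 < g) hi
  have s2 := cyclicDist_spec (by omega : 0 < g) hj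
  clear hA harc hmem
  refine ⟨hpair, ?_, ?_, ?_⟩
  · rw [Nat.even_iff]
    omega
  · omega
  · omega

end CyclicDist

section Canonical

variable {V : Type*} {G : SimpleGraph V} {g : ℕ} {vc : ZMod g → V} {S : Set V}

lemma kOf_mem (hg : 3 ≤ g) (h0 : SActive G g vc S 0) :
    kOf G g vc S < g ∧ SActive G g vc S (kOf G g vc S : ℕ) :=
  Nat.sSup_mem (s := {n : ℕ | n < g ∧ SActive G g vc S (n : ZMod g)})
    ⟨0, by omega, by simpa using h0⟩ ⟨g, fun _ hn => hn.1.le⟩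

lemma le_kOf {n : ℕ} (hn : n < g) (h : SActive G g vc S (n : ZMod g)) : n ≤ kOf G g vc S :=
  le_csSup (s := {n : ℕ | n < g ∧ SActive G g vc S (n : ZMod g)})
    ⟨g, fun _ hn => hn.1.le⟩ ⟨hn, h⟩

lemma kOf_pos (hg : 3 ≤ g) (hbi : Biactive G g vc S) : 0 < kOf G g vc S := by
  have : NeZero g := ⟨by omega⟩
  obtain ⟨a, ha, b, hb, hab⟩ := (Set.one_lt_ncard (Set.toFinite _)).mp
    (show 1 < {i : ZMod g | SActive G g vc S i}.ncard from hbi)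
  have hle : ∀ i : ZMod g, SActive G g vc S i → i.val ≤ kOf G g vc S := fun i hi =>
    le_kOf (ZMod.val_lt i) (by rwa [ZMod.natCast_zmod_val])
  by_contra h0
  have ha' := hle a ha
  have hb' := hle b hb
  exact hab (ZMod.val_injective g (by omega))

lemma cycleEdges_add_left (c : ZMod g) :
    cycleEdges g (fun x => vc (c + x)) = cycleEdges g vc := by
  ext e
  constructor
  · rintro ⟨i, rfl⟩
    exact ⟨c + i, by rw [add_assoc]⟩
  · rintro ⟨i, rfl⟩
    exact ⟨i - c, by simp [← add_assoc]⟩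

lemma SActive_add_left (c i : ZMod g) :
    SActive G g (fun x => vc (c + x)) S i ↔ SActive G g vc S (c + i) := by
  simp only [SActive, inTree, offCycle, cycleEdges_add_left]

/-- In a canonical labelling, every arc containing all active indices has length at least `k`. -/
lemma kOf_le_of_arc (hg : 3 ≤ g) (hcan : Canonical G g vc S) {b m : ℕ} (hb : b < g)
    (h : ∀ a < g, SActive G g vc S (a : ZMod g) →
      (b ≤ a ∧ a - b ≤ m) ∨ (a < b ∧ a + g - b ≤ m)) : kOf G g vc S ≤ m := by
  classical
  obtain ⟨hvc, h0, hmin⟩ := hcan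
  have hwrap : ((b + (g - b) : ℕ) : ZMod g) = 0 := by
    rw [show b + (g - b) = g by omega, ZMod.natCast_self]
  have hex : ∃ t : ℕ, SActive G g vc S ((b + t : ℕ) : ZMod g) := ⟨g - b, by rwa [hwrap]⟩
  have hspec := Nat.find_spec hex
  have hleast : ∀ t, SActive G g vc S ((b + t : ℕ) : ZMod g) → Nat.find hex ≤ t :=
    fun t ht => Nat.find_min' hex ht
  have hle := hleast (g - b) (by rwa [hwrap])
  generalize Nat.find hex = t at *
  set c : ZMod g := ((b + t : ℕ) : ZMod g) with hc
  have hlab : IsCycleLabelling G g (fun x => vc (c + x)) :=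
    ⟨fun x y hxy => add_left_cancel (hvc.1 hxy), fun i => by
      simpa only [add_assoc] using hvc.2 (c + i)⟩
  have hrange : Set.range (fun x => vc (c + x)) = Set.range vc :=
    (Equiv.addLeft c).surjective.range_comp vc
  refine (hmin _ hlab hrange ((SActive_add_left c 0).mpr (by simpa using hspec))).trans ?_
  refine csSup_le ⟨0, by omega, (SActive_add_left c _).mpr (by simpa using hspec)⟩ ?_
  rintro n ⟨hn, hact⟩
  rw [SActive_add_left, hc, ← Nat.cast_add] at hact
  by_cases hlt : b + t + n < g
  · have := h _ hlt hact
    omega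
  · have hcast : ((b + t + n : ℕ) : ZMod g) = ((b + t + n - g : ℕ) : ZMod g) := by
      rw [Nat.cast_sub (by omega), ZMod.natCast_self, sub_zero]
    rw [hcast] at hact
    have h1 := h _ (by omega) hact
    by_cases hlt' : b + t + n - g < b
    · omega
    · have := hleast (t + n - g) (by rwa [show b + (t + n - g) = b + t + n - g by omega])
      omega

lemma aS_eq_two (hg : 3 ≤ g) (h0 : SActive G g vc S 0) (hk0 : 0 < kOf G g vc S)
    (h : ∀ l < g, SActive G g vc S (l : ZMod g) → l = 0 ∨ l = kOf G g vc S) :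
    aS G g vc S = 2 := by
  have : NeZero g := ⟨by omega⟩
  have hk := kOf_mem hg h0
  have : {i : ZMod g | SActive G g vc S i} = {0, (kOf G g vc S : ZMod g)} := by
    ext i
    constructor
    · intro hi
      have := h i.val (ZMod.val_lt i) (by rwa [ZMod.natCast_zmod_val])
      rw [← ZMod.natCast_zmod_val i]
      rcases this with h | h <;> simp [h]
    · rintro (rfl | rfl)
      · exact h0
      · exact hk.2
  rw [aS, this, Set.ncard_pair (ZMod.natCast_ne_zero_of_lt hk0.ne' hk.1).symm]

end Canonical

/-- Two vertices in different trees `T_{v_i}` that are not distinguished by `S` give rise to one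
of the configurations; `u` denotes the one of larger height. -/
lemma exists_config_of_forall_dist_eq {V : Type*} [Fintype V] [DecidableEq V]
    {G : SimpleGraph V} [DecidableRel G.Adj] (hG : IsUnicyclic G) {g : ℕ} (hg : 3 ≤ g)
    {vc : ZMod g → V} (hvc : IsCycleLabelling G g vc) {S : Set V} (hbr : BranchResolving G S)
    (hbi : Biactive G g vc S) (hcan : Canonical G g vc S) {i j : ℕ} (hi : i < g) (hj : j < g)
    (hij : i ≠ j) {u v : V} (hu : inTree G g vc (i : ZMod g) u)
    (hv : inTree G g vc (j : ZMod g) v) (hle : G.dist (vc j) v ≤ G.dist (vc i) u)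
    (h : ∀ s ∈ S, G.dist s u = G.dist s v) :
    ConfigA G g vc S ∨ ConfigB G g vc S ∨ ConfigC G g vc S := by
  obtain ⟨hk, hkact⟩ := kOf_mem hg hcan.2.1
  have hk0 := kOf_pos hg hbi
  have hself : ∀ a, cyclicDist g a a = 0 := fun a => by simp [cyclicDist]
  have hcomm : ∀ a b, cyclicDist g a b = cyclicDist g b a := fun a b => by
    rw [cyclicDist, cyclicDist, max_comm, min_comm a b]
  have hpos : 0 < cyclicDist g i j := by
    unfold cyclicDist
    omega
  have htri : ∀ l < g, cyclicDist g l j ≤ cyclicDist g l i + cyclicDist g i j := fun l hl => by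
    rw [← dist_vc_eq_cyclicDist hG hg hvc hl hj, ← dist_vc_eq_cyclicDist hG hg hvc hl hi,
      ← dist_vc_eq_cyclicDist hG hg hvc hi hj]
    exact hG.1.dist_triangle
  obtain ⟨D, hD⟩ := Nat.exists_eq_add_of_le hle
  have hother : ∀ l < g, SActive G g vc S (l : ZMod g) → l ≠ i → l ≠ j →
      cyclicDist g l j = cyclicDist g l i + D := by
    rintro l hl ⟨s, hs, hls⟩ hli hlj
    have h1 := dist_eq_of_inTree hG hg hvc hl hi hli hls hu
    have h2 := dist_eq_of_inTree hG hg hvc hl hj hlj hls hv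
    have := h s hs
    omega
  have hjn : ¬ SActive G g vc S (j : ZMod g) := by
    rintro ⟨s, hs, hjs⟩
    have h1 := dist_eq_of_inTree hG hg hvc hj hi hij.symm hjs hu
    have h2 := hG.1.dist_triangle (u := s) (v := vc j) (w := v)
    rw [dist_comm (u := s) (v := vc j)] at h2
    have := h s hs
    rw [hcomm] at h1
    omega
  have hin : ∀ s ∈ S, inTree G g vc (i : ZMod g) s →
      G.dist s u = G.dist (vc i) s + cyclicDist g i j + G.dist (vc j) v := fun s hs his => by
    rw [h s hs]
    exact dist_eq_of_inTree hG hg hvc hi hj hij his hv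
  have hiD : SActive G g vc S (i : ZMod g) → cyclicDist g i j ≤ D := by
    rintro ⟨s, hs, his⟩
    have h1 := hin s hs his
    have h2 := hG.1.dist_triangle (u := s) (v := vc i) (w := u)
    rw [dist_comm (u := s) (v := vc i)] at h2
    omega
  have hDle : D ≤ cyclicDist g i j := by
    obtain ⟨l, hl, hact, hli⟩ : ∃ l < g, SActive G g vc S (l : ZMod g) ∧ l ≠ i := by
      by_cases hi0 : i = 0
      · exact ⟨_, hk, hkact, by omega⟩
      · exact ⟨0, by omega, by simpa using hcan.2.1, by omega⟩
    have h1 := hother l hl hact hli (fun h => hjn (h ▸ hact))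
    have h2 := htri l hl
    omega
  have hall : ∀ l < g, SActive G g vc S (l : ZMod g) →
      cyclicDist g l j = cyclicDist g l i + D := by
    intro l hl hact
    by_cases hli : l = i
    · subst hli
      have := hiD hact
      rw [hself]
      omega
    · exact hother l hl hact hli (fun h => hjn (h ▸ hact))
  have hthread : D ≠ 0 →
      ∃ t : List V, IsThreadAt G (vc i) t ∧ SFree S t ∧ G.dist (vc i) u ≤ t.length := by
    intro hD0
    refine (hangingTree_inTree hG hg hvc i).exists_root_thread hG.1 hbr hu ?_ ?_
    · rintro rfl
      rw [dist_self] at hD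
      omega
    · intro s hs his
      have := hin s hs his
      omega
  have harc : ∀ b m, b < g → (∀ a < g, SActive G g vc S (a : ZMod g) →
      (b ≤ a ∧ a - b ≤ m) ∨ (a < b ∧ a + g - b ≤ m)) → kOf G g vc S ≤ m :=
    fun b m hb h => kOf_le_of_arc hg hcan hb h
  rcases hDle.eq_or_lt with hDe | hDlt
  · obtain ⟨t, ht, hSt, -⟩ := hthread (by omega)
    obtain ⟨hk', hmem⟩ := index_mem_of_cyclicDist_eq_add hk hk0 hi hj hij
      (A := fun l => SActive G g vc S (l : ZMod g)) (by simpa using hcan.2.1) hkact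
      (fun l hl hA => hDe ▸ hall l hl hA) harc
    exact Or.inr (Or.inl ⟨hk', i, hmem, t, ht, hSt⟩)
  · obtain ⟨hpair, heven, hkD, hik⟩ := pair_of_cyclicDist_eq_add hk hk0 hi hj
      (A := fun l => SActive G g vc S (l : ZMod g)) (by simpa using hcan.2.1) hkact hDlt hall harc
    have h2 := aS_eq_two hg hcan.2.1 hk0 hpair
    by_cases hD0 : D = 0
    · exact Or.inl ⟨h2, heven, by omega⟩
    · obtain ⟨t, ht, hSt, hlen⟩ := hthread hD0
      exact Or.inr (Or.inr ⟨h2, heven, by omega, i, by omega, t, ht, hSt, by omega⟩)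

theorem statement_4 {V : Type*} [Fintype V] [DecidableEq V] (G : SimpleGraph V)
    [DecidableRel G.Adj] (hG : IsUnicyclic G) (g : ℕ) (hg : 3 ≤ g)
    (vc : ZMod g → V) (hvc : IsCycleLabelling G g vc)
    (S : Set V) (hbr : BranchResolving G S) (hbi : Biactive G g vc S)
    (hcan : Canonical G g vc S)
    (hconf : ¬ (ConfigA G g vc S ∨ ConfigB G g vc S ∨ ConfigC G g vc S)) :
    IsVertexMG G S := by
  intro u v huv
  by_contra! hcon
  have : NeZero g := ⟨by omega⟩
  have hidx : ∀ x, ∃ n < g, inTree G g vc (n : ZMod g) x := fun x => by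
    obtain ⟨i, hi⟩ := exists_inTree (vc := vc) hG.1 x
    exact ⟨i.val, ZMod.val_lt i, by rwa [ZMod.natCast_zmod_val]⟩
  obtain ⟨i, hi, hu⟩ := hidx u
  obtain ⟨j, hj, hv⟩ := hidx v
  by_cases hij : i = j
  · subst hij
    by_cases hh : G.dist (vc i) u = G.dist (vc i) v
    · obtain ⟨s, hs, hne⟩ :=
        (hangingTree_inTree hG hg hvc i).exists_dist_ne_of_dist_eq hG.1 hbr hu hv huv hh
      exact hne (hcon s hs)
    · obtain ⟨l, hl, ⟨s, hs, hls⟩, hli⟩ :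
          ∃ l < g, SActive G g vc S (l : ZMod g) ∧ l ≠ i := by
        have hk := kOf_mem hg hcan.2.1
        have hk0 := kOf_pos hg hbi
        by_cases hi0 : i = 0
        · exact ⟨_, hk.1, hk.2, by omega⟩
        · exact ⟨0, by omega, by simpa using hcan.2.1, by omega⟩
      have h1 := dist_eq_of_inTree hG hg hvc hl hi hli hls hu
      have h2 := dist_eq_of_inTree hG hg hvc hl hi hli hls hv
      have := hcon s hs
      omega
  · rcases le_total (G.dist (vc j) v) (G.dist (vc i) u) with hle | hle
    · exact hconf (exists_config_of_forall_dist_eq hG hg hvc hbr hbi hcan hi hj hij hu hv hle hcon)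
    · exact hconf (exists_config_of_forall_dist_eq hG hg hvc hbr hbi hcan hj hi (Ne.symm hij) hv hu
        hle fun s hs => (hcon s hs).symm)
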